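/- Let Ŷ ∈ ℝ^{n×n}, let Ψ* ∈ M_{n,k} be the membership matrix of a ground-truth partition of [n] into k clusters of equal size ℓ = n/k, and set Y* := Ψ*(Ψ*)ᵀ. Let (Ψ̌, X̌) be a ρ-approximate solution of the k-medians problem for the rows of Ŷ, i.e., Ψ̌ ∈ M_{n,k}, the rows of X̌ ∈ ℝ^{k×n} are rows of Ŷ, Ψ̌ has exactly k distinct rows, and ‖Ψ̌X̌ − Ŷ‖₁ ≤ ρ · min{‖ΨX − Ŷ‖₁ : Ψ ∈ M_{n,k}, rows of X are rows of Ŷ}. Let σ̂ assign node i to the index of the unique nonzero entry of row i of Ψ̌, and σ* the true labels. Then err(σ̂, σ*) ≤ 2(1 + 2ρ) · ‖Ŷ − Y*‖₁ / ‖Y*‖₁. -/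

import Mathlib

open Matrix Finset
open scoped BigOperators Classical

noncomputable section

def l1 {n : ℕ} (M : Matrix (Fin n) (Fin n) ℝ) : ℝ := ∑ i, ∑ j, |M i j|

def EqualClusters {n k : ℕ} (σ : Fin n → Fin k) : Prop :=
  k ∣ n ∧ ∀ a : Fin k, (Finset.univ.filter fun i => σ i = a).card = n / k

/-- the ground-truth membership matrix Ψ* associated with labels σ -/
def membershipMatrix {n k : ℕ} (σ : Fin n → Fin k) : Matrix (Fin n) (Fin k) ℝ :=
  fun i a => if σ i = a then 1 else 0

def IsMembership {n k : ℕ} (Ψ : Matrix (Fin n) (Fin k) ℝ) : Prop :=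
  (∀ i a, Ψ i a = 0 ∨ Ψ i a = 1) ∧ (∀ i, ∃! a, Ψ i a = 1) ∧ ∀ a, ∃ i, Ψ i a = 1

def KMedApprox {n k : ℕ} (ρ : ℝ) (Yhat : Matrix (Fin n) (Fin n) ℝ)
    (Ψ : Matrix (Fin n) (Fin k) ℝ) (X : Matrix (Fin k) (Fin n) ℝ) : Prop :=
  IsMembership Ψ ∧ (∀ a, ∃ i, X a = Yhat i) ∧
    ∀ (Ψ' : Matrix (Fin n) (Fin k) ℝ) (X' : Matrix (Fin k) (Fin n) ℝ),
      IsMembership Ψ' → (∀ a, ∃ i, X' a = Yhat i) →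
      l1 (Ψ * X - Yhat) ≤ ρ * l1 (Ψ' * X' - Yhat)

def misRate {n k : ℕ} (σh σs : Fin n → Fin k) : ℝ :=
  Finset.univ.inf' Finset.univ_nonempty
    (fun π : Equiv.Perm (Fin k) =>
      ((Finset.univ.filter fun i => σh i ≠ π (σs i)).card : ℝ) / n)

/-- If the predicted labels determine the true labels on `G`, and the true clusters have equal
size, then after relabelling at most `2 * #Gᶜ` nodes are mislabelled. -/
theorem exists_perm_card_mismatch_le {n k ℓ : ℕ} (σh σs : Fin n → Fin k) (G : Finset (Fin n))
    (hG : ∀ i ∈ G, ∀ j ∈ G, σh i = σh j → σs i = σs j)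
    (hℓ : ∀ a, (univ.filter fun i => σs i = a).card = ℓ) :
    ∃ π : Equiv.Perm (Fin k), (univ.filter fun i => σh i ≠ π (σs i)).card ≤ 2 * Gᶜ.card := by
  set R := G.image σs
  have hrep : ∀ a, ∃ b, a ∈ R → ∃ i ∈ G, σs i = a ∧ σh i = b := by
    intro a
    by_cases ha : a ∈ R
    · obtain ⟨i, hi, rfl⟩ := mem_image.1 ha
      exact ⟨σh i, fun _ => ⟨i, hi, rfl, rfl⟩⟩
    · exact ⟨a, fun h => absurd h ha⟩
  choose f hf using hrep
  have hinj : Set.InjOn f R := by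
    intro a ha b hb hab
    obtain ⟨i, hi, rfl, hi'⟩ := hf a ha
    obtain ⟨j, hj, rfl, hj'⟩ := hf b hb
    exact hG i hi j hj (by rw [hi', hj', hab])
  obtain ⟨g, hg⟩ := Finset.exists_equiv_extend_of_card_eq (t := (univ : Finset (Fin k)))
    (by simp) (s := R) (f := f) (subset_univ _) hinj
  let π : Equiv.Perm (Fin k) := g.trans (Equiv.subtypeUnivEquiv fun x => mem_univ x)
  have hπ : ∀ a ∈ R, π a = f a := hg
  refine ⟨π, ?_⟩
  set B := G.filter fun i => σh i ≠ π (σs i)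
  have hBG : ∀ i ∈ B, i ∈ G := fun i hi => (mem_filter.1 hi).1
  have hmis : (univ.filter fun i => σh i ≠ π (σs i)) ⊆ Gᶜ ∪ B := by
    intro i hi
    by_cases h : i ∈ G <;> simp_all [B]
  have hBcard : B.card ≤ ℓ * (B.image σs).card :=
    card_le_mul_card_image _ _ fun a _ => by
      rw [← hℓ a]; exact card_le_card (filter_subset_filter _ (subset_univ _))
  have himage : (B.image σs).card ≤ (B.image σh).card := by
    refine card_le_card_of_forall_subsingleton (fun a b => ∃ i ∈ B, σs i = a ∧ σh i = b) ?_ ?_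
    · intro a ha
      obtain ⟨i, hi, rfl⟩ := mem_image.1 ha
      exact ⟨σh i, mem_image_of_mem _ hi, i, hi, rfl, rfl⟩
    · rintro b - a ⟨-, i, hi, rfl, hib⟩ a' ⟨-, j, hj, rfl, hjb⟩
      exact hG i (hBG i hi) j (hBG j hj) (hib.trans hjb.symm)
  have hdisj : Disjoint (B.image σh) (R.image f) := by
    rw [disjoint_left]
    rintro b hb hb'
    obtain ⟨i, hi, rfl⟩ := mem_image.1 hb
    obtain ⟨a, ha, hai⟩ := mem_image.1 hb'
    obtain ⟨j, hj, rfl, hj'⟩ := hf a ha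
    have hij := hG i (hBG i hi) j hj (by rw [hj', hai])
    refine (mem_filter.1 hi).2 ?_
    rw [hij, hπ _ ha, hai]
  have hsum : (B.image σh).card + R.card ≤ k := by
    rw [← card_image_of_injOn hinj, ← card_union_of_disjoint hdisj]
    simpa using card_le_univ (B.image σh ∪ R.image f)
  have hRc : (B.image σs).card ≤ Rᶜ.card := by
    rw [card_compl, Fintype.card_fin]; omega
  have hbad : Rᶜ.card * ℓ ≤ Gᶜ.card := by
    have : (univ.filter fun i => σs i ∈ Rᶜ).card = Rᶜ.card * ℓ := by
      rw [card_eq_sum_card_fiberwise (f := σs) (t := Rᶜ) (by intro i hi; simpa using hi),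
        sum_const_nat]
      intro a ha
      rw [← hℓ a, filter_filter]
      congr 1
      ext i
      simp only [mem_filter, mem_univ, true_and, and_iff_right_iff_imp]
      rintro rfl
      exact ha
    rw [← this]
    refine card_le_card fun i hi => ?_
    rw [mem_compl]
    intro hiG
    exact mem_compl.1 (mem_filter.1 hi).2 (mem_image_of_mem _ hiG)
  calc _ ≤ _ := card_le_card hmis
    _ ≤ _ := card_union_le _ _
    _ ≤ 2 * Gᶜ.card := by nlinarith [Nat.mul_le_mul_left ℓ hRc]

/-- Multiplying by a membership matrix copies out the rows selected by the labels. -/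
theorem IsMembership.mul_apply {n k : ℕ} {Ψ : Matrix (Fin n) (Fin k) ℝ} (hΨ : IsMembership Ψ)
    {σ : Fin n → Fin k} (hσ : ∀ i, Ψ i (σ i) = 1) (X : Matrix (Fin k) (Fin n) ℝ) (i j : Fin n) :
    (Ψ * X) i j = X (σ i) j := by
  rw [Matrix.mul_apply, sum_eq_single (σ i)]
  · rw [hσ, one_mul]
  · intro b _ hb
    rcases hΨ.1 i b with h | h
    · rw [h, zero_mul]
    · exact absurd ((hΨ.2.1 i).unique h (hσ i)) hb
  · simp

theorem isMembership_membershipMatrix {n k : ℕ} {σ : Fin n → Fin k}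
    (hσ : Function.Surjective σ) : IsMembership (membershipMatrix σ) := by
  refine ⟨fun i a => ?_, fun i => ⟨σ i, ?_, fun b hb => ?_⟩, fun a => ?_⟩
  · by_cases h : σ i = a <;> simp [membershipMatrix, h]
  · simp [membershipMatrix]
  · by_contra h
    simp [membershipMatrix, Ne.symm h] at hb
  · obtain ⟨i, rfl⟩ := hσ a
    exact ⟨i, by simp [membershipMatrix]⟩

theorem membershipMatrix_mul_transpose_apply {n k : ℕ} (σ : Fin n → Fin k) (i j : Fin n) :
    (membershipMatrix σ * (membershipMatrix σ)ᵀ) i j = if σ j = σ i then 1 else 0 := by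
  simp [Matrix.mul_apply, membershipMatrix, eq_comm]

/-- The indicator vectors of different clusters of size `ℓ` are at `ℓ¹` distance `2ℓ`. -/
theorem sum_abs_indicator_sub_indicator {n k ℓ : ℕ} {σ : Fin n → Fin k}
    (hℓ : ∀ a, (univ.filter fun i => σ i = a).card = ℓ) {a b : Fin k} (hab : a ≠ b) :
    ∑ m, |(if σ m = a then (1 : ℝ) else 0) - (if σ m = b then 1 else 0)| = 2 * ℓ := by
  have h : ∀ m, |(if σ m = a then (1 : ℝ) else 0) - (if σ m = b then 1 else 0)| =
      (if σ m = a then 1 else 0) + (if σ m = b then 1 else 0) := by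
    intro m
    by_cases ha : σ m = a
    · simp [ha, hab]
    · by_cases hb : σ m = b <;> simp [ha, hb, hab.symm]
  simp only [h, sum_add_distrib, sum_boole, hℓ]
  ring

/-- If the rows of `Z` are constant on clusters, choosing from each cluster the row of `Y` closest
to `Z` approximates `Y` within `2 * l1 (Y - Z)`. -/
theorem exists_rows_l1_sub_le {n k : ℕ} {σ : Fin n → Fin k} (hσ : Function.Surjective σ)
    (Y Z : Matrix (Fin n) (Fin n) ℝ) (hZ : ∀ i j, σ i = σ j → Z i = Z j) :
    ∃ X : Matrix (Fin k) (Fin n) ℝ, (∀ a, ∃ i, X a = Y i) ∧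
      l1 (membershipMatrix σ * X - Y) ≤ 2 * l1 (Y - Z) := by
  have hbest : ∀ a, ∃ i, σ i = a ∧ ∀ j, σ j = a → ∑ m, |(Y - Z) i m| ≤ ∑ m, |(Y - Z) j m| := by
    intro a
    obtain ⟨i, hi, hmin⟩ := exists_min_image (univ.filter fun i => σ i = a)
      (fun i => ∑ m, |(Y - Z) i m|) ((hσ a).imp fun i hi => by simpa using hi)
    exact ⟨i, by simpa using hi, fun j hj => hmin j (by simpa using hj)⟩
  choose r hr hmin using hbest
  refine ⟨Y.submatrix r id, fun a => ⟨r a, rfl⟩, ?_⟩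
  rw [l1, l1, mul_sum]
  refine sum_le_sum fun i _ => ?_
  have hrow : ∑ m, |(membershipMatrix σ * Y.submatrix r id - Y) i m| ≤
      ∑ m, |(Y - Z) (r (σ i)) m| + ∑ m, |(Y - Z) i m| := by
    rw [← sum_add_distrib]
    refine sum_le_sum fun m _ => ?_
    rw [Matrix.sub_apply, (isMembership_membershipMatrix hσ).mul_apply (σ := σ)
      (fun i => by simp [membershipMatrix]), Matrix.sub_apply, Matrix.sub_apply,
      hZ _ i (hr (σ i)), abs_sub_comm (Y i m), Matrix.submatrix_apply, id]
    exact abs_sub_le _ (Z i m) _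
  linarith [hmin (σ i) i rfl]

/-- Proposition 3: the clustering extracted from a ρ-approximate k-medians solution on the
rows of `Ŷ` satisfies `err(σ̂,σ*) ≤ 2(1+2ρ)·‖Ŷ − Y*‖₁/‖Y*‖₁`, where `Y* = Ψ*(Ψ*)ᵀ`. -/
theorem kmedian_error_bound {n k : ℕ} (σstar : Fin n → Fin k)
    (hclusters : EqualClusters σstar) (hn : 0 < n) (hk : 0 < k) (hkn : k ≤ n)
    (ρ : ℝ) (hρ : 1 ≤ ρ)
    (Yhat : Matrix (Fin n) (Fin n) ℝ)
    (Ψ : Matrix (Fin n) (Fin k) ℝ) (X : Matrix (Fin k) (Fin n) ℝ)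
    (happrox : KMedApprox ρ Yhat Ψ X)
    (hkrows : (Finset.univ.image fun i => Ψ i).card = k)
    (σhat : Fin n → Fin k) (hσhat : ∀ i, Ψ i (σhat i) = 1) :
    misRate σhat σstar ≤
      2 * (1 + 2 * ρ) *
        (l1 (Yhat - membershipMatrix σstar * (membershipMatrix σstar)ᵀ) /
          l1 (membershipMatrix σstar * (membershipMatrix σstar)ᵀ)) := by
  obtain ⟨-, hℓ⟩ := hclusters
  obtain ⟨hΨ, -, hopt⟩ := happrox
  set ℓ := n / k
  have hℓpos : 0 < ℓ := Nat.div_pos hkn hk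
  have hsurj : Function.Surjective σstar := by
    intro a
    obtain ⟨i, hi⟩ := card_pos.1 ((hℓ a).symm ▸ hℓpos)
    exact ⟨i, by simpa using hi⟩
  set Y := membershipMatrix σstar * (membershipMatrix σstar)ᵀ
  have hYapply : ∀ i j, Y i j = if σstar j = σstar i then 1 else 0 :=
    membershipMatrix_mul_transpose_apply σstar
  have hnorm : l1 Y = n * ℓ := by
    have habs : ∀ i j, |Y i j| = if σstar j = σstar i then 1 else 0 := fun i j => by
      rw [hYapply]; split_ifs <;> simp
    simp only [l1, habs, sum_boole, hℓ, sum_const, card_univ, Fintype.card_fin, nsmul_eq_mul]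
  obtain ⟨X', hX', hle⟩ := exists_rows_l1_sub_le hsurj Yhat Y fun i j h => by
    ext m; rw [hYapply, hYapply, h]
  have hfit := hopt _ X' (isMembership_membershipMatrix hsurj) hX'
  set D := l1 (Yhat - Y) with hD
  have hdist : ∑ i, ∑ m, |X (σhat i) m - Y i m| ≤ (1 + 2 * ρ) * D := by
    have htri : ∑ i, ∑ m, |X (σhat i) m - Y i m| ≤ l1 (Ψ * X - Yhat) + D := by
      rw [hD, l1, l1, ← sum_add_distrib]
      refine sum_le_sum fun i _ => ?_
      rw [← sum_add_distrib]
      refine sum_le_sum fun m _ => ?_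
      rw [Matrix.sub_apply, Matrix.sub_apply, hΨ.mul_apply hσhat]
      exact abs_sub_le _ _ _
    nlinarith
  set G := univ.filter fun i => ∑ m, |X (σhat i) m - Y i m| < (ℓ : ℝ) with hGdef
  have hG : ∀ i ∈ G, ∀ j ∈ G, σhat i = σhat j → σstar i = σstar j := by
    intro i hi j hj hij
    by_contra hne
    have hsep := sum_abs_indicator_sub_indicator hℓ hne
    have htri : ∑ m, |(if σstar m = σstar i then (1 : ℝ) else 0) -
        (if σstar m = σstar j then 1 else 0)| ≤
        ∑ m, |X (σhat i) m - Y i m| + ∑ m, |X (σhat j) m - Y j m| := by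
      rw [← sum_add_distrib]
      refine sum_le_sum fun m _ => ?_
      rw [← hYapply, ← hYapply, hij, abs_sub_comm _ (Y i m)]
      exact abs_sub_le _ _ _
    linarith [(mem_filter.1 hi).2, (mem_filter.1 hj).2]
  have hbad : (Gᶜ.card : ℝ) * ℓ ≤ (1 + 2 * ρ) * D := by
    refine le_trans ?_ hdist
    rw [← nsmul_eq_mul]
    refine (card_nsmul_le_sum Gᶜ (fun i => ∑ m, |X (σhat i) m - Y i m|) _ fun i hi => ?_).trans
      (sum_le_sum_of_subset_of_nonneg (subset_univ _) fun i _ _ => by positivity)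
    simpa [hGdef] using hi
  obtain ⟨π, hπ⟩ := exists_perm_card_mismatch_le σhat σstar G hG hℓ
  refine (inf'_le _ (mem_univ π)).trans ?_
  have hn' : (0 : ℝ) < n := by exact_mod_cast hn
  have hℓ' : (0 : ℝ) < ℓ := by exact_mod_cast hℓpos
  have hπ' : ((univ.filter fun i => σhat i ≠ π (σstar i)).card : ℝ) ≤ 2 * Gᶜ.card := by
    exact_mod_cast hπ
  rw [hnorm, ← mul_div_assoc, div_le_div_iff₀ hn' (by positivity)]
  have hfinal : ((univ.filter fun i => σhat i ≠ π (σstar i)).card : ℝ) * ℓ ≤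
      2 * (1 + 2 * ρ) * D := by
    nlinarith
  nlinarith
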